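/- arXiv:2301.01059 — 4 statements merged into one kernel-verified Lean document; each statement's English description precedes it below -/
import Mathlib

section
/- Let X →a E →p T →ξ ΣX be a distinguished triangle in C such that Hom_C(T, ΣT) = 0 and ξ ≠ 0. Then dim_k Hom_C(T, ΣE) < dim_k Hom_C(T, ΣX). -/
open CategoryTheory CategoryTheory.Limits CategoryTheory.Pretriangulated

/-- Let `X →a E →p T →ξ ΣX` be a distinguished triangle in a `k`-linear
Hom-finite pretriangulated category `C` such that `Hom_C(T, ΣT) = 0` and `ξ ≠ 0`.
Then `dim_k Hom_C(T, ΣE) < dim_k Hom_C(T, ΣX)`. -/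
theorem stmt_0 {k : Type*} [Field k] {C : Type*} [Category C] [Preadditive C]
    [Linear k C] [HasZeroObject C] [HasShift C ℤ]
    [∀ n : ℤ, (shiftFunctor C n).Additive] [Pretriangulated C]
    [homFinite : ∀ A B : C, FiniteDimensional k (A ⟶ B)]
    {X E T : C} (a : X ⟶ E) (p : E ⟶ T) (ξ : T ⟶ X⟦(1:ℤ)⟧)
    (hdist : Triangle.mk a p ξ ∈ distTriang C)
    (hrigid : ∀ f : T ⟶ T⟦(1:ℤ)⟧, f = 0) (hξ : ξ ≠ 0) :
    Module.finrank k (T ⟶ E⟦(1:ℤ)⟧) < Module.finrank k (T ⟶ X⟦(1:ℤ)⟧) := by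
  let φ : (T ⟶ X⟦(1:ℤ)⟧) →ₗ[k] (T ⟶ E⟦(1:ℤ)⟧) := Linear.rightComp k T (a⟦(1:ℤ)⟧')
  have hsurj : Function.Surjective φ := fun f => by
    obtain ⟨g, hg⟩ := Triangle.coyoneda_exact₃ _
      (rot_of_distTriang _ (rot_of_distTriang _ hdist)) f (hrigid _)
    refine ⟨-g, ?_⟩
    rw [hg]
    exact (Preadditive.neg_comp _ _).trans (Preadditive.comp_neg _ _).symm
  have hker : ξ ∈ LinearMap.ker φ := comp_distTriang_mor_zero₃₁ _ hdist
  have hpos : 0 < Module.finrank k (LinearMap.ker φ) := by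
    have : Nontrivial (LinearMap.ker φ) :=
      Submodule.nontrivial_iff_ne_bot.mpr ((Submodule.ne_bot_iff _).mpr ⟨ξ, hker, hξ⟩)
    exact Module.finrank_pos
  have hrank := φ.finrank_range_add_finrank_ker
  rw [LinearMap.range_eq_top.mpr hsurj, finrank_top] at hrank
  omega
end

section
/- Let T →u Y →v X →δ ΣT be a distinguished triangle in C such that Hom_C(T, ΣT) = 0 and δ ≠ 0. Then dim_k Hom_C(Y, ΣT) < dim_k Hom_C(X, ΣT). -/
open CategoryTheory CategoryTheory.Limits CategoryTheory.Pretriangulated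

/-- Let `T →u Y →v X →δ ΣT` be a distinguished triangle in a `k`-linear
Hom-finite pretriangulated category `C` such that `Hom_C(T, ΣT) = 0` and `δ ≠ 0`.
Then `dim_k Hom_C(Y, ΣT) < dim_k Hom_C(X, ΣT)`. -/
theorem stmt_2 {k : Type*} [Field k] {C : Type*} [Category C] [Preadditive C]
    [Linear k C] [HasZeroObject C] [HasShift C ℤ]
    [∀ n : ℤ, (shiftFunctor C n).Additive] [Pretriangulated C]
    [homFinite : ∀ A B : C, FiniteDimensional k (A ⟶ B)]
    {T Y X : C} (u : T ⟶ Y) (v : Y ⟶ X) (δ : X ⟶ T⟦(1:ℤ)⟧)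
    (hdist : Triangle.mk u v δ ∈ distTriang C)
    (hrigid : ∀ f : T ⟶ T⟦(1:ℤ)⟧, f = 0) (hδ : δ ≠ 0) :
    Module.finrank k (Y ⟶ T⟦(1:ℤ)⟧) < Module.finrank k (X ⟶ T⟦(1:ℤ)⟧) := by
  have hvδ : v ≫ δ = 0 := comp_distTriang_mor_zero₂₃ _ hdist
  let φ := Linear.leftComp k (T⟦(1:ℤ)⟧) v
  have hsurj : Function.Surjective φ := fun f ↦ by
    obtain ⟨g, hg⟩ := Triangle.yoneda_exact₂ _ hdist f (hrigid _)
    exact ⟨g, hg.symm⟩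
  have hker : 0 < Module.finrank k φ.ker :=
    Module.finrank_pos_iff_exists_ne_zero.2
      ⟨⟨δ, hvδ⟩, fun h ↦ hδ (congrArg Subtype.val h)⟩
  have hrank := φ.finrank_range_add_finrank_ker
  rw [LinearMap.range_eq_top.2 hsurj, finrank_top] at hrank
  lia
end

section
/- Let T be a rigid object of C, let L and M be objects of C, and set V = (T)(L, ΣM). Assume that dim_k (T)(M, ΣL) = dim_k Hom_C(L, ΣM) − dim_k V. Then Ker β_{L,M}(V, ?) := { g ∈ Hom_C(M, ΣL) : β_{L,M}(f, g) = 0 for every f ∈ V } is equal to (T)(M, ΣL). -/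
open CategoryTheory CategoryTheory.Limits CategoryTheory.Pretriangulated

/-- A 2-Calabi–Yau structure on a `k`-linear category `C` with shift `Σ = ⟦1⟧`:
a family of non-degenerate bifunctorial `k`-bilinear forms
`β_{L,M} : Hom_C(L,ΣM) × Hom_C(M,ΣL) → k`. -/
structure TwoCYStructure (k : Type*) [Field k] (C : Type*) [Category C]
    [Preadditive C] [Linear k C] [HasShift C ℤ] where
  β : ∀ L M : C, (L ⟶ M⟦(1:ℤ)⟧) →ₗ[k] (M ⟶ L⟦(1:ℤ)⟧) →ₗ[k] k
  nondeg_left : ∀ (L M : C) (f : L ⟶ M⟦(1:ℤ)⟧), (∀ g : M ⟶ L⟦(1:ℤ)⟧, β L M f g = 0) → f = 0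
  nondeg_right : ∀ (L M : C) (g : M ⟶ L⟦(1:ℤ)⟧), (∀ f : L ⟶ M⟦(1:ℤ)⟧, β L M f g = 0) → g = 0
  bifunctorial_left : ∀ {L M N : C} (f : L ⟶ M) (ε : M ⟶ N⟦(1:ℤ)⟧) (η : N ⟶ L⟦(1:ℤ)⟧),
    β L N (f ≫ ε) η = β M N ε (η ≫ f⟦(1:ℤ)⟧')
  bifunctorial_right : ∀ {M N P : C} (g : N ⟶ P) (ε : M ⟶ N⟦(1:ℤ)⟧) (δ : P ⟶ M⟦(1:ℤ)⟧),
    β M P (ε ≫ g⟦(1:ℤ)⟧') δ = β M N ε (g ≫ δ)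

/-- The subspace `(T)(X, Y) ⊆ Hom_C(X, Y)` of morphisms factoring through an object of
`add T`: equivalently, the `k`-span of morphisms factoring through `T` itself. -/
def factorsThroughAdd (k : Type*) [Field k] {C : Type*} [Category C]
    [Preadditive C] [Linear k C] (T X Y : C) : Submodule k (X ⟶ Y) :=
  Submodule.span k {f : X ⟶ Y | ∃ (g : X ⟶ T) (h : T ⟶ Y), f = g ≫ h}

/-- The right orthogonal of a subspace under a non-degenerate pairing of finite-dimensional vector
spaces has complementary dimension. -/
theorem LinearMap.finrank_dualCoannihilator_map {k E F : Type*} [Field k]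
    [AddCommGroup E] [Module k E] [AddCommGroup F] [Module k F]
    [FiniteDimensional k E] [FiniteDimensional k F] (B : E →ₗ[k] F →ₗ[k] k)
    (hleft : ∀ x, (∀ y, B x y = 0) → x = 0) (hright : ∀ y, (∀ x, B x y = 0) → y = 0)
    (V : Submodule k E) :
    Module.finrank k (V.map B).dualCoannihilator = Module.finrank k E - Module.finrank k V := by
  have hB : Function.Injective B := (injective_iff_map_eq_zero B).2 fun x hx ↦
    hleft x fun y ↦ by simp [hx]
  have hflip : Function.Injective B.flip := (injective_iff_map_eq_zero B.flip).2 fun y hy ↦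
    hright y fun x ↦ by simpa using LinearMap.congr_fun hy x
  have hEF : Module.finrank k E ≤ Module.finrank k F :=
    (LinearMap.finrank_le_finrank_of_injective hB).trans_eq Subspace.dual_finrank_eq
  have hFE : Module.finrank k F ≤ Module.finrank k E :=
    (LinearMap.finrank_le_finrank_of_injective hflip).trans_eq Subspace.dual_finrank_eq
  have hV : Module.finrank k (V.map B) = Module.finrank k V :=
    (Submodule.equivMapOfInjective B hB V).finrank_eq.symm
  have hsum := Subspace.finrank_add_finrank_dualCoannihilator_eq (V.map B)
  rw [← hV, le_antisymm hEF hFE, ← hsum]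
  exact (Nat.add_sub_cancel_left _ _).symm

/-- Morphisms factoring through a rigid object are orthogonal under a 2-Calabi–Yau structure. -/
theorem TwoCYStructure.β_eq_zero_of_mem_factorsThroughAdd {k : Type*} [Field k] {C : Type*}
    [Category C] [Preadditive C] [Linear k C] [HasShift C ℤ] (cy : TwoCYStructure k C)
    {T L M : C} (hrigid : ∀ φ : T ⟶ T⟦(1:ℤ)⟧, φ = 0)
    {f : L ⟶ M⟦(1:ℤ)⟧} (hf : f ∈ factorsThroughAdd k T L (M⟦(1:ℤ)⟧))
    {g : M ⟶ L⟦(1:ℤ)⟧} (hg : g ∈ factorsThroughAdd k T M (L⟦(1:ℤ)⟧)) :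
    cy.β L M f g = 0 := by
  unfold factorsThroughAdd at hf hg
  induction hf using Submodule.span_induction with
  | zero => simp
  | add _ _ _ _ hx hy => simp [hx, hy]
  | smul _ _ _ hx => simp [hx]
  | mem _ hmem =>
    obtain ⟨a, b, rfl⟩ := hmem
    induction hg using Submodule.span_induction with
    | zero => simp
    | add _ _ _ _ hx hy => simp [hx, hy]
    | smul _ _ _ hx => simp [hx]
    | mem _ hmem =>
      obtain ⟨c, d, rfl⟩ := hmem
      rw [cy.bifunctorial_left, Category.assoc, hrigid (d ≫ a⟦(1:ℤ)⟧'), comp_zero, map_zero]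

/-- Let `T` be a rigid object, `L`, `M` objects of `C`, and
`V = (T)(L, ΣM)`. If `dim_k (T)(M, ΣL) = dim_k Hom_C(L, ΣM) − dim_k V`, then
`Ker β_{L,M}(V, ?) = { g : β_{L,M}(f,g) = 0 for all f ∈ V }` equals `(T)(M, ΣL)`. -/
theorem stmt_5 {k : Type*} [Field k] {C : Type*} [Category C] [Preadditive C]
    [Linear k C] [HasZeroObject C] [HasShift C ℤ]
    [∀ n : ℤ, (shiftFunctor C n).Additive] [Pretriangulated C]
    [homFinite : ∀ A B : C, FiniteDimensional k (A ⟶ B)]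
    (cy : TwoCYStructure k C)
    (T : C) (hrigid : ∀ φ : T ⟶ T⟦(1:ℤ)⟧, φ = 0)
    (L M : C)
    (hdim : Module.finrank k (factorsThroughAdd k T M (L⟦(1:ℤ)⟧))
      = Module.finrank k (L ⟶ M⟦(1:ℤ)⟧)
        - Module.finrank k (factorsThroughAdd k T L (M⟦(1:ℤ)⟧))) :
    {g : M ⟶ L⟦(1:ℤ)⟧ | ∀ f ∈ factorsThroughAdd k T L (M⟦(1:ℤ)⟧), cy.β L M f g = 0}
      = (factorsThroughAdd k T M (L⟦(1:ℤ)⟧) : Set (M ⟶ L⟦(1:ℤ)⟧)) := by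
  have hperp : {g : M ⟶ L⟦(1:ℤ)⟧ | ∀ f ∈ factorsThroughAdd k T L (M⟦(1:ℤ)⟧), cy.β L M f g = 0}
      = (((factorsThroughAdd k T L (M⟦(1:ℤ)⟧)).map (cy.β L M)).dualCoannihilator :
        Set (M ⟶ L⟦(1:ℤ)⟧)) := by
    ext g
    simp [Submodule.mem_dualCoannihilator]
  rw [hperp]
  refine congrArg SetLike.coe (Submodule.eq_of_le_of_finrank_eq (fun g hg ↦ ?_) ?_).symm
  · rw [Submodule.mem_dualCoannihilator]
    rintro _ ⟨f, hf, rfl⟩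
    exact cy.β_eq_zero_of_mem_factorsThroughAdd hrigid hf hg
  · rw [hdim, (cy.β L M).finrank_dualCoannihilator_map (cy.nondeg_left L M) (cy.nondeg_right L M)]
end

section
/- Let T be an object of C with Hom_C(T, ΣT) = 0, and let T →u Y →v X →δ ΣT be a distinguished triangle with δ ≠ 0. Then dim_k Hom_C(T, ΣY) < dim_k Hom_C(T, ΣX). -/
open CategoryTheory CategoryTheory.Limits CategoryTheory.Pretriangulated

theorem TwoCYStructure.finrank_hom_shift_le {k : Type*} [Field k] {C : Type*} [Category C]
    [Preadditive C] [Linear k C] [HasShift C ℤ]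
    [∀ A B : C, FiniteDimensional k (A ⟶ B)]
    (cy : TwoCYStructure k C) (L M : C) :
    Module.finrank k (L ⟶ M⟦(1:ℤ)⟧) ≤ Module.finrank k (M ⟶ L⟦(1:ℤ)⟧) := by
  rw [← Subspace.dual_finrank_eq (K := k) (V := M ⟶ L⟦(1:ℤ)⟧)]
  refine LinearMap.finrank_le_finrank_of_injective (f := cy.β L M) ?_
  rw [injective_iff_map_eq_zero]
  intro f hf
  exact cy.nondeg_left L M f fun g ↦ by rw [hf, LinearMap.zero_apply]

theorem TwoCYStructure.finrank_hom_shift_comm {k : Type*} [Field k] {C : Type*} [Category C]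
    [Preadditive C] [Linear k C] [HasShift C ℤ]
    [∀ A B : C, FiniteDimensional k (A ⟶ B)]
    (cy : TwoCYStructure k C) (L M : C) :
    Module.finrank k (L ⟶ M⟦(1:ℤ)⟧) = Module.finrank k (M ⟶ L⟦(1:ℤ)⟧) :=
  le_antisymm (cy.finrank_hom_shift_le L M) (cy.finrank_hom_shift_le M L)

/-- A surjective linear map with nonzero kernel strictly lowers the dimension. -/
theorem LinearMap.finrank_lt_of_surjective_of_apply_eq_zero {k V W : Type*} [Field k]
    [AddCommGroup V] [Module k V] [FiniteDimensional k V] [AddCommGroup W] [Module k W]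
    (φ : V →ₗ[k] W) (hφ : Function.Surjective φ) {x : V} (hx : x ≠ 0) (hφx : φ x = 0) :
    Module.finrank k W < Module.finrank k V := by
  have hker : LinearMap.ker φ ≠ ⊥ := fun h ↦ hx ((Submodule.eq_bot_iff _).1 h x hφx)
  have hpos := Submodule.one_le_finrank_iff.2 hker
  have hsum := φ.finrank_range_add_finrank_ker
  rw [LinearMap.range_eq_top.2 hφ, finrank_top] at hsum
  lia

/-- Let `C` carry a 2-Calabi–Yau structure, let `T` be an object with
`Hom_C(T, ΣT) = 0`, and let `T →u Y →v X →δ ΣT` be a distinguished triangle with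
`δ ≠ 0`. Then `dim_k Hom_C(T, ΣY) < dim_k Hom_C(T, ΣX)`. -/
theorem stmt_9 {k : Type*} [Field k] {C : Type*} [Category C] [Preadditive C]
    [Linear k C] [HasZeroObject C] [HasShift C ℤ]
    [∀ n : ℤ, (shiftFunctor C n).Additive] [Pretriangulated C]
    [homFinite : ∀ A B : C, FiniteDimensional k (A ⟶ B)]
    (cy : TwoCYStructure k C)
    {T Y X : C} (hrigid : ∀ f : T ⟶ T⟦(1:ℤ)⟧, f = 0)
    (u : T ⟶ Y) (v : Y ⟶ X) (δ : X ⟶ T⟦(1:ℤ)⟧)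
    (hdist : Triangle.mk u v δ ∈ distTriang C) (hδ : δ ≠ 0) :
    Module.finrank k (T ⟶ Y⟦(1:ℤ)⟧) < Module.finrank k (T ⟶ X⟦(1:ℤ)⟧) := by
  rw [cy.finrank_hom_shift_comm T Y, cy.finrank_hom_shift_comm T X]
  refine LinearMap.finrank_lt_of_surjective_of_apply_eq_zero
    (Linear.leftComp k (T⟦(1:ℤ)⟧) v) (fun ε ↦ ?_) hδ (comp_distTriang_mor_zero₂₃ _ hdist)
  obtain ⟨g, hg⟩ := Triangle.yoneda_exact₂ _ hdist ε (hrigid _)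
  exact ⟨g, hg.symm⟩
end
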